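/- Assume (A, B₂, E) is stabilizable, (A, C, E) has no unobservable purely imaginary modes, and there exists a stabilizing solution X∞ of the indefinite Riccati equation R(X) = 0. Let (X_k)_{k≥0}, (W_k)_{k≥1} be a Riccati iteration sequence in which every W_{k+1} is a stabilizing solution of its step Riccati equation. Then the sequence of iterates converges to the stabilizing solution: X_k → X∞ as k → ∞ (entrywise, equivalently in any matrix norm). -/

import Mathlib

open Matrix

/-- The Riccati operator `R(X) = AᵀXE + EᵀXA − EᵀX(B₂B₂ᵀ − B₁B₁ᵀ)XE + CᵀC`. -/
noncomputable def Ric {n m₁ m₂ p : ℕ} (A E : Matrix (Fin n) (Fin n) ℝ)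
    (B₁ : Matrix (Fin n) (Fin m₁) ℝ) (B₂ : Matrix (Fin n) (Fin m₂) ℝ)
    (C : Matrix (Fin p) (Fin n) ℝ) (X : Matrix (Fin n) (Fin n) ℝ) :
    Matrix (Fin n) (Fin n) ℝ :=
  Aᵀ * X * E + Eᵀ * X * A - Eᵀ * X * (B₂ * B₂ᵀ - B₁ * B₁ᵀ) * X * E + Cᵀ * C

/-- A real square matrix is stable if all of its eigenvalues (as a complex matrix)
have negative real part. -/
def IsStableMat {n : ℕ} (M : Matrix (Fin n) (Fin n) ℝ) : Prop :=
  ∀ μ ∈ spectrum ℂ (M.map (algebraMap ℝ ℂ)), μ.re < 0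

/-- A Riccati iteration sequence: symmetric matrices `X k` (k ≥ 0) and `W k` (k ≥ 1)
with `X 0 = 0`, `X (k+1) = X k + W (k+1)`, and `W (k+1)` solving the step Riccati
equation with coefficient `A_k = A + (B₁B₁ᵀ − B₂B₂ᵀ)X_kE`. -/
noncomputable def RiccatiIter {n m₁ m₂ p : ℕ} (A E : Matrix (Fin n) (Fin n) ℝ)
    (B₁ : Matrix (Fin n) (Fin m₁) ℝ) (B₂ : Matrix (Fin n) (Fin m₂) ℝ)
    (C : Matrix (Fin p) (Fin n) ℝ)
    (X W : ℕ → Matrix (Fin n) (Fin n) ℝ) : Prop :=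
  X 0 = 0 ∧ (∀ k, (X k).IsSymm) ∧ (∀ k, (W (k + 1)).IsSymm) ∧
  (∀ k, X (k + 1) = X k + W (k + 1)) ∧
  (∀ k, (A + (B₁ * B₁ᵀ - B₂ * B₂ᵀ) * X k * E)ᵀ * W (k + 1) * E
      + Eᵀ * W (k + 1) * (A + (B₁ * B₁ᵀ - B₂ * B₂ᵀ) * X k * E)
      - Eᵀ * W (k + 1) * (B₂ * B₂ᵀ) * W (k + 1) * E
      + Ric A E B₁ B₂ C (X k) = 0)


section Aux

variable {n : ℕ}

theorem mem_spectrum_iff_exists_mulVec (M : Matrix (Fin n) (Fin n) ℂ) (μ : ℂ) :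
    μ ∈ spectrum ℂ M ↔ ∃ v, v ≠ 0 ∧ M *ᵥ v = μ • v := by
  rw [spectrum.mem_iff, Matrix.isUnit_iff_isUnit_det, isUnit_iff_ne_zero, not_not,
    ← Matrix.exists_mulVec_eq_zero_iff]
  refine exists_congr fun v => and_congr_right fun _ => ?_
  rw [Matrix.sub_mulVec, sub_eq_zero, Matrix.algebraMap_eq_diagonal, eq_comm]
  have : (diagonal ((algebraMap ℂ (Fin n → ℂ)) μ)) *ᵥ v = μ • v := by
    ext i; simp [Matrix.mulVec_diagonal]
  rw [this]

section
attribute [local instance] Matrix.linftyOpNormedRing Matrix.linftyOpNormedAlgebra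

theorem tendsto_pow_zero_of_spectrum (U : Matrix (Fin n) (Fin n) ℂ)
    (h : ∀ μ ∈ spectrum ℂ U, ‖μ‖ < 1) :
    Filter.Tendsto (fun k : ℕ => U ^ k) Filter.atTop (nhds 0) := by
  rcases isEmpty_or_nonempty (Fin n) with hn | hn
  · exact (tendsto_const_nhds (x := (0 : Matrix (Fin n) (Fin n) ℂ))).congr
      fun k => Subsingleton.elim _ _
  have hr : spectralRadius ℂ U < ((1 : NNReal) : ENNReal) :=
    spectrum.spectralRadius_lt_of_forall_lt U fun μ hμ => h μ hμ
  obtain ⟨r, hr1, hr2⟩ := ENNReal.lt_iff_exists_nnreal_btwn.1 hr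
  have hlim := (spectrum.pow_nnnorm_pow_one_div_tendsto_nhds_spectralRadius U).eventually
    (gt_mem_nhds hr1)
  have hr3 : r < 1 := by exact_mod_cast hr2
  refine tendsto_zero_iff_norm_tendsto_zero.2 ?_
  refine squeeze_zero' (.of_forall fun _ => norm_nonneg _) ?_
    (tendsto_pow_atTop_nhds_zero_of_lt_one r.2 hr3)
  filter_upwards [hlim, Filter.eventually_gt_atTop 0] with k hk hk0
  have h1 : ((‖U ^ k‖₊ : ENNReal) ^ (1 / (k : ℝ))) ^ (k : ℝ) ≤ (r : ENNReal) ^ (k : ℝ) :=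
    ENNReal.rpow_le_rpow hk.le (by positivity)
  rw [← ENNReal.rpow_mul, one_div, inv_mul_cancel₀ (by positivity), ENNReal.rpow_one,
    ENNReal.rpow_natCast] at h1
  exact_mod_cast h1
end

theorem eq_zero_of_mul_eq_mul (M N V : Matrix (Fin n) (Fin n) ℂ) (h : M * V = V * N)
    (hd : ∀ μ ∈ spectrum ℂ M, μ ∉ spectrum ℂ N) : V = 0 := by
  rcases isEmpty_or_nonempty (Fin n) with hn | hn
  · exact Subsingleton.elim _ _
  have hp : ∀ p : Polynomial ℂ, Polynomial.aeval M p * V = V * Polynomial.aeval N p := by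
    intro p
    induction p using Polynomial.induction_on' with
    | add p q hp hq => simp [add_mul, mul_add, hp, hq]
    | monomial k a =>
      have hk : M ^ k * V = V * N ^ k := by
        have : SemiconjBy V N M := h.symm
        exact (this.pow_right k).symm
      simp [Polynomial.aeval_monomial, Algebra.algebraMap_eq_smul_one, hk]
  have h0 := hp N.charpoly
  rw [Matrix.aeval_self_charpoly, mul_zero] at h0
  have hu : IsUnit (Polynomial.aeval M N.charpoly) := by
    rw [← spectrum.zero_notMem_iff ℂ, spectrum.map_polynomial_aeval_of_nonempty]
    · rintro ⟨μ, hμ, hμ0⟩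
      exact hd μ hμ (Matrix.mem_spectrum_iff_isRoot_charpoly.2 hμ0)
    · exact spectrum.nonempty_of_isAlgClosed_of_finiteDimensional ℂ M
  exact hu.mul_right_eq_zero.1 h0

theorem re_nonpos_of_tendsto {M : ℕ → Matrix (Fin n) (Fin n) ℂ} {N : Matrix (Fin n) (Fin n) ℂ}
    (h : Filter.Tendsto M Filter.atTop (nhds N))
    (hM : ∀ k, ∀ μ ∈ spectrum ℂ (M k), μ.re < 0) : ∀ μ ∈ spectrum ℂ N, μ.re ≤ 0 := by
  intro μ hμ
  by_contra! hpos
  rw [Matrix.mem_spectrum_iff_isRoot_charpoly, Polynomial.IsRoot, Matrix.eval_charpoly] at hμ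
  have hlim : Filter.Tendsto (fun k => ‖(Matrix.scalar (Fin n) μ - M k).det‖) Filter.atTop
      (nhds ‖(Matrix.scalar (Fin n) μ - N).det‖) := by
    have : Continuous fun L : Matrix (Fin n) (Fin n) ℂ => ‖(Matrix.scalar (Fin n) μ - L).det‖ := by
      fun_prop
    exact (this.tendsto N).comp h
  have hbound : ∀ k, μ.re ^ n ≤ ‖(Matrix.scalar (Fin n) μ - M k).det‖ := by
    intro k
    have hs := IsAlgClosed.splits (M k).charpoly
    rw [← Matrix.eval_charpoly, hs.eval_eq_prod_roots_of_monic (Matrix.charpoly_monic _)]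
    have hc : (M k).charpoly.roots.card = n := by
      rw [← hs.natDegree_eq_card_roots, Matrix.charpoly_natDegree_eq_dim, Fintype.card_fin]
    have key : ∀ s : Multiset ℂ, (∀ z ∈ s, z.re < 0) →
        μ.re ^ s.card ≤ ‖(s.map fun z => μ - z).prod‖ := by
      intro s
      induction s using Multiset.induction_on with
      | empty => simp
      | cons a s ih =>
        intro hs
        rw [Multiset.card_cons, pow_succ', Multiset.map_cons, Multiset.prod_cons, norm_mul]
        have h1 : μ.re ≤ ‖μ - a‖ := by
          have := (le_abs_self _).trans (Complex.abs_re_le_norm (μ - a))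
          have h2 := hs a (Multiset.mem_cons_self _ _)
          rw [Complex.sub_re] at this
          linarith
        exact mul_le_mul h1 (ih fun z hz => hs z (Multiset.mem_cons_of_mem hz)) (by positivity)
          (norm_nonneg _)
    have := key (M k).charpoly.roots fun z hz => hM k z <|
      Matrix.mem_spectrum_iff_isRoot_charpoly.2 (Polynomial.isRoot_of_mem_roots hz)
    rwa [hc] at this
  have := ge_of_tendsto' hlim hbound
  rw [hμ, norm_zero] at this
  exact absurd this (not_le.2 (by positivity))

theorem IsStableMat.re_neg {M : Matrix (Fin n) (Fin n) ℝ} (hM : IsStableMat M) {μ : ℂ}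
    {v : Fin n → ℂ} (hv : v ≠ 0) (h : M.map (algebraMap ℝ ℂ) *ᵥ v = μ • v) : μ.re < 0 :=
  hM μ ((mem_spectrum_iff_exists_mulVec _ _).2 ⟨v, hv, h⟩)

theorem IsStableMat.isUnit_one_sub {A : Matrix (Fin n) (Fin n) ℝ} (hA : IsStableMat A) :
    IsUnit (1 - A).det := by
  rw [isUnit_iff_ne_zero]
  intro h0
  obtain ⟨v, hv, h⟩ := Matrix.exists_mulVec_eq_zero_iff.2 h0
  rw [Matrix.sub_mulVec, Matrix.one_mulVec, sub_eq_zero] at h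
  have h1 : A.map (algebraMap ℝ ℂ) *ᵥ (algebraMap ℝ ℂ ∘ v) = (1 : ℂ) • (algebraMap ℝ ℂ ∘ v) := by
    ext i
    rw [← RingHom.map_mulVec, ← h, one_smul, Function.comp_apply]
  have h2 : (algebraMap ℝ ℂ ∘ v) ≠ 0 := by
    contrapose! hv
    ext i
    simpa using congrFun hv i
  have := hA.re_neg h2 h1
  norm_num at this

theorem IsStableMat.norm_cayley_lt_one {A N : Matrix (Fin n) (Fin n) ℝ} (hA : IsStableMat A)
    (hN : (1 - A) * N = 1) :
    ∀ μ ∈ spectrum ℂ (((1 + A) * N).map (algebraMap ℝ ℂ)), ‖μ‖ < 1 := by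
  intro μ hμ
  obtain ⟨x, hx, h⟩ := (mem_spectrum_iff_exists_mulVec _ _).1 hμ
  by_contra! hge
  set y := N.map (algebraMap ℝ ℂ) *ᵥ x with hy
  set a := A.map (algebraMap ℝ ℂ) with ha
  have h1 : x = y - a *ᵥ y := by
    have := congrArg (fun M => (algebraMap ℝ ℂ).mapMatrix M *ᵥ x) hN
    simp only [map_mul, map_sub, map_one, RingHom.mapMatrix_apply, ← Matrix.mulVec_mulVec,
      Matrix.sub_mulVec, Matrix.one_mulVec] at this
    exact this.symm
  have h2 : y + a *ᵥ y = μ • x := by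
    rw [← h]
    have : ((1 + A) * N).map (algebraMap ℝ ℂ) = (1 + a) * N.map (algebraMap ℝ ℂ) := by
      simp only [← RingHom.mapMatrix_apply, map_mul, map_add, map_one, ha]
    rw [this, ← Matrix.mulVec_mulVec, Matrix.add_mulVec, Matrix.one_mulVec]
  have hy0 : y ≠ 0 := by
    intro h0
    rw [h0] at h1
    simp at h1
    exact hx h1
  have h3 : (1 + μ) • (a *ᵥ y) = (μ - 1) • y := by
    rw [h1] at h2
    ext i
    have := congrFun h2 i
    simp only [Pi.add_apply, Pi.smul_apply, Pi.sub_apply, smul_eq_mul] at this ⊢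
    linear_combination this
  have hμ1 : 1 + μ ≠ 0 := by
    intro h0
    rw [h0, zero_smul, eq_comm, smul_eq_zero] at h3
    rcases h3 with h3 | h3
    · have : (2 : ℂ) = 0 := by linear_combination h0 - h3
      norm_num at this
    · exact hy0 h3
  have h4 : a *ᵥ y = ((μ - 1) / (1 + μ)) • y := by
    rw [div_eq_inv_mul, mul_smul, ← h3, smul_smul, inv_mul_cancel₀ hμ1, one_smul]
  have h5 := hA.re_neg hy0 h4
  have h6 : 0 < Complex.normSq (1 + μ) := Complex.normSq_pos.2 hμ1
  have h7 : 1 ≤ Complex.normSq μ := by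
    rw [Complex.normSq_eq_norm_sq]; nlinarith
  rw [Complex.div_re, ← add_div, div_neg_iff] at h5
  rw [Complex.normSq_apply] at h7
  simp only [Complex.sub_re, Complex.one_re, Complex.add_re, Complex.sub_im, Complex.one_im,
    Complex.add_im] at h5
  rcases h5 with h5 | h5
  · linarith [h5.2]
  · nlinarith [h5.1]

theorem posSemidef_of_lyapunov {A P Q : Matrix (Fin n) (Fin n) ℝ} (hA : IsStableMat A)
    (hP : P.IsSymm) (hQ : Q.PosSemidef) (h : Aᵀ * P + P * A + Q = 0) : P.PosSemidef := by
  obtain ⟨N, hN⟩ : ∃ N, (1 - A) * N = 1 := ⟨_, Matrix.mul_nonsing_inv _ hA.isUnit_one_sub⟩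
  set U := (1 + A) * N with hU
  have hstein : P - Uᵀ * P * U = (2 : ℝ) • (Nᵀ * Q * N) := by
    have h1 : P = Nᵀ * ((1 - Aᵀ) * P * (1 - A)) * N := by
      have : Nᵀ * (1 - Aᵀ) = 1 := by
        rw [← Matrix.transpose_one, ← Matrix.transpose_sub, ← Matrix.transpose_mul, hN]
      calc P = (Nᵀ * (1 - Aᵀ)) * P * ((1 - A) * N) := by rw [this, hN, one_mul, mul_one]
        _ = _ := by noncomm_ring
    have h2 : Uᵀ * P * U = Nᵀ * ((1 + Aᵀ) * P * (1 + A)) * N := by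
      rw [hU, Matrix.transpose_mul, Matrix.transpose_add, Matrix.transpose_one]
      noncomm_ring
    have h3 : Q = -(Aᵀ * P + P * A) := (neg_eq_of_add_eq_zero_right h).symm
    rw [h2, h3, two_smul]
    nth_rewrite 1 [h1]
    noncomm_ring
  have hdec : ∀ x, (U *ᵥ x) ⬝ᵥ P *ᵥ (U *ᵥ x) ≤ x ⬝ᵥ P *ᵥ x := by
    intro x
    have h1 : (P - Uᵀ * P * U).PosSemidef := by
      rw [hstein]
      have := hQ.conjTranspose_mul_mul_same N
      rw [Matrix.conjTranspose_eq_transpose_of_trivial] at this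
      exact this.smul (by norm_num)
    have h2 := h1.dotProduct_mulVec_nonneg x
    have h3 : x ⬝ᵥ (Uᵀ * P * U) *ᵥ x = (U *ᵥ x) ⬝ᵥ P *ᵥ (U *ᵥ x) := by
      rw [← Matrix.mulVec_mulVec, ← Matrix.mulVec_mulVec, Matrix.dotProduct_mulVec,
        Matrix.vecMul_transpose]
    rw [Matrix.sub_mulVec, star_trivial, dotProduct_sub, h3] at h2
    linarith
  have hdec' : ∀ k x, ((U ^ k) *ᵥ x) ⬝ᵥ P *ᵥ ((U ^ k) *ᵥ x) ≤ x ⬝ᵥ P *ᵥ x := by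
    intro k x
    induction k with
    | zero => simp
    | succ k ih =>
      rw [pow_succ', ← Matrix.mulVec_mulVec]
      exact (hdec _).trans ih
  have hU0 : Filter.Tendsto (fun k : ℕ => U ^ k) Filter.atTop (nhds 0) := by
    have h1 := tendsto_pow_zero_of_spectrum _ (hA.norm_cayley_lt_one hN)
    have h2 : Continuous fun L : Matrix (Fin n) (Fin n) ℂ => L.map Complex.re :=
      continuous_id.matrix_map Complex.continuous_re
    have h3 := (h2.tendsto 0).comp h1
    have h4 : (0 : Matrix (Fin n) (Fin n) ℂ).map Complex.re = 0 := by ext; simp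
    rw [h4] at h3
    refine h3.congr fun k => ?_
    have : (U.map (algebraMap ℝ ℂ)) ^ k = (U ^ k).map (algebraMap ℝ ℂ) := by
      simp only [← RingHom.mapMatrix_apply, map_pow]
    rw [Function.comp_apply, ← hU, this]
    ext i j
    simp
  refine .of_dotProduct_mulVec_nonneg hP fun x => ?_
  rw [star_trivial]
  have hc : Continuous fun L : Matrix (Fin n) (Fin n) ℝ => (L *ᵥ x) ⬝ᵥ P *ᵥ (L *ᵥ x) := by
    fun_prop
  have := le_of_tendsto' ((hc.tendsto 0).comp hU0) fun k => hdec' k x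
  simpa using this

open scoped MatrixOrder ComplexOrder in
theorem Matrix.PosSemidef.map_ofReal {V : Matrix (Fin n) (Fin n) ℝ} (hV : V.PosSemidef) :
    (V.map (algebraMap ℝ ℂ)).PosSemidef := by
  obtain ⟨B, rfl⟩ := CStarAlgebra.nonneg_iff_eq_star_mul_self.mp hV.nonneg
  have : (star B * B).map (algebraMap ℝ ℂ)
      = (B.map (algebraMap ℝ ℂ))ᴴ * B.map (algebraMap ℝ ℂ) := by
    rw [Matrix.map_mul]
    congr 1
    ext i j
    simp [Matrix.star_apply]
  rw [this]
  exact posSemidef_conjTranspose_mul_self _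

open scoped ComplexOrder in
theorem isStableMat_of_lyapunov {F V S T R : Matrix (Fin n) (Fin n) ℝ} (hV : V.PosSemidef)
    (hS : S.PosSemidef) (hT : T.PosSemidef) (hR : R.PosSemidef)
    (h : Fᵀ * V + V * F + V * T * V + V * S * V + R = 0) (hFS : IsStableMat (F + S * V)) :
    IsStableMat F := by
  intro μ hμ
  obtain ⟨v, hv, hFv⟩ := (mem_spectrum_iff_exists_mulVec _ _).1 hμ
  by_contra! hge
  replace hV := hV.map_ofReal
  replace hS := hS.map_ofReal
  replace hT := hT.map_ofReal
  replace hR := hR.map_ofReal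
  have hc := congrArg (algebraMap ℝ ℂ).mapMatrix h
  have hFt : Fᵀ.map (algebraMap ℝ ℂ) = (F.map (algebraMap ℝ ℂ))ᴴ := by
    ext i j; simp
  have hstab := @IsStableMat.re_neg _ _ hFS μ v hv
  have hsum : (F + S * V).map (algebraMap ℝ ℂ)
      = F.map (algebraMap ℝ ℂ) + S.map (algebraMap ℝ ℂ) * V.map (algebraMap ℝ ℂ) := by
    simp only [← RingHom.mapMatrix_apply, map_mul, map_add]
  simp only [map_mul, map_add, map_zero, RingHom.mapMatrix_apply, hFt] at hc
  rw [hsum] at hstab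
  generalize F.map (algebraMap ℝ ℂ) = f at *
  generalize V.map (algebraMap ℝ ℂ) = P at *
  generalize S.map (algebraMap ℝ ℂ) = s at *
  generalize T.map (algebraMap ℝ ℂ) = t at *
  generalize R.map (algebraMap ℝ ℂ) = r at *
  have hq := congrArg (fun M => star v ⬝ᵥ M *ᵥ v) hc
  have hPv : ∀ M : Matrix (Fin n) (Fin n) ℂ,
      star v ⬝ᵥ (P * M * P) *ᵥ v = star (P *ᵥ v) ⬝ᵥ M *ᵥ (P *ᵥ v) := by
    intro M
    rw [← Matrix.mulVec_mulVec, ← Matrix.mulVec_mulVec, Matrix.dotProduct_mulVec, Matrix.star_mulVec,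
      hV.isHermitian.eq]
  have h1 : star v ⬝ᵥ (fᴴ * P) *ᵥ v = star μ * (star v ⬝ᵥ P *ᵥ v) := by
    rw [← Matrix.mulVec_mulVec, Matrix.dotProduct_mulVec, ← Matrix.star_mulVec, hFv, star_smul,
      smul_dotProduct, smul_eq_mul]
  have h2 : star v ⬝ᵥ (P * f) *ᵥ v = μ * (star v ⬝ᵥ P *ᵥ v) := by
    rw [← Matrix.mulVec_mulVec, hFv, Matrix.mulVec_smul, dotProduct_smul, smul_eq_mul]
  simp only [Matrix.add_mulVec, dotProduct_add, hPv, h1, h2, Matrix.zero_mulVec,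
    dotProduct_zero] at hq
  have p1 := hV.dotProduct_mulVec_nonneg v
  have p2 := hT.dotProduct_mulVec_nonneg (P *ᵥ v)
  have p3 := hS.dotProduct_mulVec_nonneg (P *ᵥ v)
  have p4 := hR.dotProduct_mulVec_nonneg v
  have hz : star (P *ᵥ v) ⬝ᵥ s *ᵥ (P *ᵥ v) = 0 := by
    rw [Complex.le_def] at p1 p2 p3 p4
    have hre := congrArg Complex.re hq
    simp only [Complex.add_re, Complex.mul_re, Complex.star_def, Complex.conj_re,
      Complex.conj_im, ← p1.2, Complex.zero_im, Complex.zero_re] at hre p1 p2 p3 p4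
    apply Complex.ext
    · have := mul_nonneg hge p1.1
      simp only [Complex.zero_re]
      linarith [p1.1, p2.1, p3.1, p4.1]
    · exact p3.2.symm
  have hz' := (hS.dotProduct_mulVec_zero_iff _).1 hz
  have := hstab (by rw [Matrix.add_mulVec, ← Matrix.mulVec_mulVec, hz', add_zero, hFv])
  linarith

theorem exists_tendsto_of_monotone_bounded {X : ℕ → Matrix (Fin n) (Fin n) ℝ}
    {Y : Matrix (Fin n) (Fin n) ℝ} (hsymm : ∀ k, (X k).IsSymm)
    (hmono : ∀ k, (X (k + 1) - X k).PosSemidef) (hbdd : ∀ k, (Y - X k).PosSemidef) :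
    ∃ L, Filter.Tendsto X Filter.atTop (nhds L) := by
  have hq : ∀ x : Fin n → ℝ, ∃ l, Filter.Tendsto (fun k => x ⬝ᵥ X k *ᵥ x) Filter.atTop (nhds l) := by
    intro x
    refine ⟨_, tendsto_atTop_ciSup (monotone_nat_of_le_succ fun k => ?_)
      ⟨x ⬝ᵥ Y *ᵥ x, ?_⟩⟩
    · have := (hmono k).dotProduct_mulVec_nonneg x
      rw [Matrix.sub_mulVec, star_trivial, dotProduct_sub] at this
      linarith
    · rintro _ ⟨k, rfl⟩
      have := (hbdd k).dotProduct_mulVec_nonneg x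
      rw [Matrix.sub_mulVec, star_trivial, dotProduct_sub] at this
      linarith
  have hentry : ∀ i j, ∃ l, Filter.Tendsto (fun k => X k i j) Filter.atTop (nhds l) := by
    intro i j
    obtain ⟨a, ha⟩ := hq (Pi.single i 1 + Pi.single j 1)
    obtain ⟨b, hb⟩ := hq (Pi.single i 1)
    obtain ⟨c, hc⟩ := hq (Pi.single j 1)
    refine ⟨(a - b - c) / 2, (((ha.sub hb).sub hc).div_const 2).congr fun k => ?_⟩
    have := (hsymm k).apply i j
    simp only [Matrix.mulVec_add, dotProduct_add, add_dotProduct, Matrix.mulVec_single_one,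
      single_one_dotProduct, Matrix.col_apply]
    rw [this]
    ring
  choose L hL using hentry
  exact ⟨L, tendsto_pi_nhds.2 fun i => tendsto_pi_nhds.2 fun j => hL i j⟩

theorem tendsto_stabilizing_of_riccati_iteration {A S T Q Y : Matrix (Fin n) (Fin n) ℝ}
    (hS : S.PosSemidef) (hT : T.PosSemidef) (hQ : Q.PosSemidef) (hY : Y.PosSemidef)
    (hYsol : Aᵀ * Y + Y * A - Y * (T - S) * Y + Q = 0) (hYstab : IsStableMat (A + (S - T) * Y))
    {X W : ℕ → Matrix (Fin n) (Fin n) ℝ} (hX0 : X 0 = 0) (hX : ∀ k, (X k).IsSymm)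
    (hW : ∀ k, (W (k + 1)).IsSymm) (hsucc : ∀ k, X (k + 1) = X k + W (k + 1))
    (hstep : ∀ k, (A + (S - T) * X k)ᵀ * W (k + 1) + W (k + 1) * (A + (S - T) * X k)
      - W (k + 1) * T * W (k + 1)
      + (Aᵀ * X k + X k * A - X k * (T - S) * X k + Q) = 0)
    (hstab : ∀ k, IsStableMat (A + (S - T) * X k - T * W (k + 1))) :
    Filter.Tendsto X Filter.atTop (nhds Y) := by
  have hSt : Sᵀ = S := hS.isHermitian
  have hTt : Tᵀ = T := hT.isHermitian
  have hYt : Yᵀ = Y := hY.isHermitian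
  have hXt : ∀ k, (X k)ᵀ = X k := hX
  have hWt : ∀ k, (W (k + 1))ᵀ = W (k + 1) := hW
  have congr_psd : ∀ {P M : Matrix (Fin n) (Fin n) ℝ}, P.PosSemidef → Mᵀ = M →
      (M * P * M).PosSemidef := by
    intro P M hP hM
    have := hP.mul_mul_conjTranspose_same M
    rwa [Matrix.conjTranspose_eq_transpose_of_trivial, hM] at this
  have hWpsd : ∀ k, (Aᵀ * X k + X k * A - X k * (T - S) * X k + Q).PosSemidef →
      (W (k + 1)).PosSemidef := by
    intro k hR
    refine posSemidef_of_lyapunov (hstab k) (hW k) ((congr_psd hT (hWt k)).add hR) ?_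
    rw [← hstep k]
    simp only [Matrix.transpose_add, Matrix.transpose_sub, Matrix.transpose_mul, hSt, hTt, hXt, hWt]
    noncomm_ring
  have hind : ∀ k, (Y - X k).PosSemidef ∧
      (Aᵀ * X k + X k * A - X k * (T - S) * X k + Q).PosSemidef := by
    intro k
    induction k with
    | zero => simpa [hX0] using ⟨hY, hQ⟩
    | succ k ih =>
      obtain ⟨hV, hR⟩ := ih
      have hVt : (Y - X k)ᵀ = Y - X k := hV.isHermitian
      have hDt : (Y - X (k + 1))ᵀ = Y - X (k + 1) := by
        rw [Matrix.transpose_sub, hYt, hXt]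
      constructor
      · have hF : IsStableMat (A + S * X k - T * Y) := by
          refine isStableMat_of_lyapunov hV hS hT hR ?_ (by convert hYstab using 1; noncomm_ring)
          rw [← hYsol]
          simp only [Matrix.transpose_add, Matrix.transpose_sub, Matrix.transpose_mul, hSt, hTt,
            hXt, hYt]
          noncomm_ring
        refine posSemidef_of_lyapunov hF hDt ((congr_psd hS hVt).add (congr_psd hT hDt)) ?_
        rw [← sub_zero (0 : Matrix (Fin n) (Fin n) ℝ)]
        nth_rewrite 1 [← hYsol]
        rw [← hstep k, hsucc]
        simp only [Matrix.transpose_add, Matrix.transpose_sub, Matrix.transpose_mul, hSt, hTt,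
          hXt, hYt]
        noncomm_ring
      · have : Aᵀ * X (k + 1) + X (k + 1) * A - X (k + 1) * (T - S) * X (k + 1) + Q
            = W (k + 1) * S * W (k + 1) := by
          rw [← sub_zero (Aᵀ * _ + _ - _ + _), ← hstep k, hsucc]
          simp only [Matrix.transpose_add, Matrix.transpose_sub, Matrix.transpose_mul, hSt, hTt,
            hXt]
          noncomm_ring
        rw [this]
        exact congr_psd hS (hWt k)
  obtain ⟨L, hL⟩ := exists_tendsto_of_monotone_bounded hX
    (fun k => by rw [hsucc, add_sub_cancel_left]; exact hWpsd k (hind k).2) (fun k => (hind k).1)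
  have hWlim : Filter.Tendsto (fun k => W (k + 1)) Filter.atTop (nhds 0) := by
    have := ((Filter.tendsto_add_atTop_iff_nat 1).2 hL).sub hL
    rw [sub_self] at this
    exact this.congr fun k => by rw [hsucc, add_sub_cancel_left]
  have hLsol : Aᵀ * L + L * A - L * (T - S) * L + Q = 0 := by
    have hc : Continuous fun p : Matrix (Fin n) (Fin n) ℝ × Matrix (Fin n) (Fin n) ℝ =>
        (A + (S - T) * p.1)ᵀ * p.2 + p.2 * (A + (S - T) * p.1) - p.2 * T * p.2
          + (Aᵀ * p.1 + p.1 * A - p.1 * (T - S) * p.1 + Q) := by fun_prop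
    have h1 := (hc.tendsto (L, 0)).comp (hL.prodMk_nhds hWlim)
    have h2 := tendsto_nhds_unique h1 ((tendsto_const_nhds (x := 0)).congr fun k => (hstep k).symm)
    simpa using h2
  have hLstab : ∀ μ ∈ spectrum ℂ ((A + (S - T) * L).map (algebraMap ℝ ℂ)), μ.re ≤ 0 := by
    have hc : Continuous fun p : Matrix (Fin n) (Fin n) ℝ × Matrix (Fin n) (Fin n) ℝ =>
        (A + (S - T) * p.1 - T * p.2).map (algebraMap ℝ ℂ) :=
      Continuous.matrix_map (by fun_prop) Complex.continuous_ofReal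
    have h1 := (hc.tendsto (L, 0)).comp (hL.prodMk_nhds hWlim)
    simp only [mul_zero, sub_zero] at h1
    exact re_nonpos_of_tendsto h1 fun k => hstab k
  have hV : (Y - L).map (algebraMap ℝ ℂ) = 0 := by
    refine eq_zero_of_mul_eq_mul ((A + (S - T) * Y).map (algebraMap ℝ ℂ))ᵀ
      (-(A + (S - T) * L).map (algebraMap ℝ ℂ)) _ ?_ ?_
    · have : (A + (S - T) * Y)ᵀ * (Y - L) = (Y - L) * -(A + (S - T) * L) := by
        rw [← sub_eq_zero, ← sub_zero (0 : Matrix (Fin n) (Fin n) ℝ)]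
        nth_rewrite 1 [← hYsol]
        rw [← hLsol]
        simp only [Matrix.transpose_add, Matrix.transpose_sub, Matrix.transpose_mul, hSt, hTt, hYt]
        noncomm_ring
      have := congrArg (algebraMap ℝ ℂ).mapMatrix this
      simpa only [map_mul, map_neg, RingHom.mapMatrix_apply, Matrix.transpose_map] using this
    · intro μ h1 h2
      rw [Matrix.mem_spectrum_iff_isRoot_charpoly, Matrix.charpoly_transpose,
        ← Matrix.mem_spectrum_iff_isRoot_charpoly] at h1
      have h3 := hYstab μ h1
      rw [← spectrum.neg_eq, Set.mem_neg] at h2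
      have h4 := hLstab _ h2
      rw [Complex.neg_re] at h4
      linarith
  have hLY : L = Y := by
    ext i j
    have := congrFun (congrFun hV i) j
    simp only [Matrix.map_apply, Matrix.sub_apply, Matrix.zero_apply, map_eq_zero] at this
    linarith
  exact hLY ▸ hL

end Aux

/-- The Riccati iteration converges to the stabilizing solution. -/
theorem riccati_iteration_converges {n m₁ m₂ p : ℕ}
    (A E : Matrix (Fin n) (Fin n) ℝ) (hE : IsUnit E.det)
    (B₁ : Matrix (Fin n) (Fin m₁) ℝ) (B₂ : Matrix (Fin n) (Fin m₂) ℝ)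
    (C : Matrix (Fin p) (Fin n) ℝ)
    (hstabilizable : ∃ K : Matrix (Fin m₂) (Fin n) ℝ, IsStableMat (E⁻¹ * (A - B₂ * K)))
    (hdetect : ∀ (l : ℂ) (v : Fin n → ℂ), l.re = 0 →
      (l • E.map (algebraMap ℝ ℂ) - A.map (algebraMap ℝ ℂ)).mulVec v = 0 →
      (C.map (algebraMap ℝ ℂ)).mulVec v = 0 → v = 0)
    (Xinf : Matrix (Fin n) (Fin n) ℝ) (hXinfPSD : Xinf.PosSemidef)
    (hXinfSol : Ric A E B₁ B₂ C Xinf = 0)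
    (hXinfStab : IsStableMat (E⁻¹ * (A + (B₁ * B₁ᵀ - B₂ * B₂ᵀ) * Xinf * E)))
    (X W : ℕ → Matrix (Fin n) (Fin n) ℝ)
    (hiter : RiccatiIter A E B₁ B₂ C X W)
    (hstab : ∀ k : ℕ, IsStableMat (E⁻¹ * ((A + (B₁ * B₁ᵀ - B₂ * B₂ᵀ) * X k * E)
      - B₂ * B₂ᵀ * W (k + 1) * E))) :
    Filter.Tendsto X Filter.atTop (nhds Xinf) := by
  obtain ⟨hX0, hX, hW, hsucc, hstep⟩ := hiter
  have hi : E⁻¹ * E = 1 := Matrix.nonsing_inv_mul E hE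
  have hi' : E * E⁻¹ = 1 := Matrix.mul_nonsing_inv E hE
  have ht' : E⁻¹ᵀ * Eᵀ = 1 := by rw [← Matrix.transpose_mul, hi', Matrix.transpose_one]
  have c1 : ∀ M, E * (E⁻¹ * M) = M := fun M => by rw [← Matrix.mul_assoc, hi', Matrix.one_mul]
  have c2 : ∀ M, E⁻¹ᵀ * (Eᵀ * M) = M := fun M => by rw [← Matrix.mul_assoc, ht', Matrix.one_mul]
  have hpsd : ∀ {m : ℕ} (B : Matrix (Fin n) (Fin m) ℝ),
      (E⁻¹ * (B * Bᵀ) * E⁻¹ᵀ).PosSemidef := fun B => by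
    simpa only [Matrix.conjTranspose_eq_transpose_of_trivial] using
      (posSemidef_self_mul_conjTranspose B).mul_mul_conjTranspose_same E⁻¹
  have hsymm : ∀ {M : Matrix (Fin n) (Fin n) ℝ}, M.IsSymm → (Eᵀ * M * E).IsSymm := fun {M} hM => by
    simp only [Matrix.IsSymm, Matrix.transpose_mul, Matrix.transpose_transpose, hM.eq,
      Matrix.mul_assoc]
  have hlim := tendsto_stabilizing_of_riccati_iteration (A := E⁻¹ * A) (Q := Cᵀ * C)
    (Y := Eᵀ * Xinf * E) (X := fun k => Eᵀ * X k * E) (W := fun k => Eᵀ * W k * E)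
    (hpsd B₁) (hpsd B₂)
    (by simpa only [Matrix.conjTranspose_eq_transpose_of_trivial] using
      posSemidef_conjTranspose_mul_self C)
    (by simpa only [Matrix.conjTranspose_eq_transpose_of_trivial] using
      hXinfPSD.conjTranspose_mul_mul_same E)
    (by
      rw [← hXinfSol, Ric]
      simp only [Matrix.transpose_mul, Matrix.mul_sub, Matrix.sub_mul, Matrix.mul_assoc, c1, c2])
    (by
      convert hXinfStab using 1
      simp only [Matrix.mul_add, Matrix.mul_sub, Matrix.sub_mul, Matrix.mul_assoc, c2])
    (by simp [hX0]) (fun k => hsymm (hX k)) (fun k => hsymm (hW k))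
    (fun k => by simp only [hsucc, Matrix.mul_add, Matrix.add_mul])
    (fun k => by
      rw [← hstep k, Ric]
      simp only [Matrix.transpose_add, Matrix.transpose_sub, Matrix.transpose_mul,
        Matrix.transpose_transpose, Matrix.mul_add, Matrix.add_mul, Matrix.mul_sub, Matrix.sub_mul,
        Matrix.mul_assoc, c1, c2])
    (fun k => by
      convert hstab k using 1
      simp only [Matrix.mul_add, Matrix.mul_sub, Matrix.sub_mul, Matrix.mul_assoc, c2])
  have hc : Continuous fun M : Matrix (Fin n) (Fin n) ℝ => E⁻¹ᵀ * M * E⁻¹ := by fun_prop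
  have hback : ∀ M, E⁻¹ᵀ * (Eᵀ * M * E) * E⁻¹ = M := fun M => by
    simp only [Matrix.mul_assoc, c2, hi', Matrix.mul_one]
  have := (hc.tendsto _).comp hlim
  rw [hback] at this
  exact this.congr fun k => hback _
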